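/- arXiv:1502.06930 — 5 statements merged into one kernel-verified Lean document; each statement's English description precedes it below -/
import Mathlib

section
/- Let D ∈ ℝ^{m×L} be a matrix, x ∈ ℝ^L a vector with x ∉ Range(D^T), and λ ≥ 0. Let γ̂_λ denote a minimizer of ½‖x − D^Tγ‖₂² over {γ ∈ ℝ^m : ‖γ‖_∞ ≤ λ}. Then the vector u* = (x − D^Tγ̂_λ) / ‖x − D^Tγ̂_λ‖₂ is a minimizer of the penalized objective u ↦ −⟨x, u⟩ + λ‖Du‖₁ over the set {u ∈ ℝ^L : ‖u‖₂² ≤ 1}. (This is Corollary 1 of the paper, with x = Y ×₂ v ×₃ w.) -/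
open Finset

/-- **Corollary 1 of the paper.**  Let `D ∈ ℝ^{m×L}`, `x ∈ ℝ^L` with `x ∉ Range(Dᵀ)`, and
`λ ≥ 0`.  Let `γ̂_λ` be a minimizer of `½‖x − Dᵀγ‖₂²` over `{γ : ‖γ‖_∞ ≤ λ}`.  Then
`u* = (x − Dᵀγ̂_λ) / ‖x − Dᵀγ̂_λ‖₂` minimizes `u ↦ −⟨x, u⟩ + λ‖Du‖₁` over
`{u : ‖u‖₂² ≤ 1}`. -/
theorem stmt_1 {m L : ℕ} (D : Matrix (Fin m) (Fin L) ℝ) (x : Fin L → ℝ)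
    (lam : ℝ) (hlam : 0 ≤ lam)
    (hx : x ∉ Set.range D.transpose.mulVec)
    (gammaHat : Fin m → ℝ)
    (hmem : ∀ i, |gammaHat i| ≤ lam)
    (hmin : IsMinOn (fun γ : Fin m → ℝ =>
        (1 / 2) * ∑ i, (x i - D.transpose.mulVec γ i) ^ 2)
      {γ : Fin m → ℝ | ∀ i, |γ i| ≤ lam} gammaHat) :
    IsMinOn (fun u : Fin L → ℝ => -(∑ i, x i * u i) + lam * ∑ j, |D.mulVec u j|)
      {u : Fin L → ℝ | (∑ i, u i ^ 2) ≤ 1}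
      (fun i => (x i - D.transpose.mulVec gammaHat i) /
        Real.sqrt (∑ k, (x k - D.transpose.mulVec gammaHat k) ^ 2)) := by
  classical
  set r : Fin L → ℝ := fun i => x i - D.transpose.mulVec gammaHat i with hr
  have key : ∀ (γ : Fin m → ℝ) (u : Fin L → ℝ),
      ∑ i, D.transpose.mulVec γ i * u i = ∑ j, γ j * D.mulVec u j := by
    intro γ u
    change D.transpose.mulVec γ ⬝ᵥ u = γ ⬝ᵥ D.mulVec u
    rw [Matrix.mulVec_transpose, Matrix.dotProduct_mulVec]
  have hS : 0 < ∑ k, r k ^ 2 := by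
    rcases (Finset.sum_nonneg (fun k _ => sq_nonneg (r k)) :
      0 ≤ ∑ k, r k ^ 2).lt_or_eq with h | h
    · exact h
    · exfalso
      apply hx
      refine ⟨gammaHat, ?_⟩
      funext i
      have h2 := (Finset.sum_eq_zero_iff_of_nonneg
        (fun k _ => sq_nonneg (r k))).1 h.symm i (Finset.mem_univ i)
      have h3 : r i = 0 := by simpa using h2
      simp only [hr] at h3
      linarith
  -- variational inequality
  have hvar : ∀ γ : Fin m → ℝ, (∀ i, |γ i| ≤ lam) →
      ∑ j, γ j * D.mulVec r j ≤ ∑ j, gammaHat j * D.mulVec r j := by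
    intro γ hγ
    by_contra hcon
    push Not at hcon
    set d : Fin L → ℝ := fun i => D.transpose.mulVec (γ - gammaHat) i with hd
    set a : ℝ := ∑ i, d i * r i with ha
    have haeq : a = ∑ j, γ j * D.mulVec r j - ∑ j, gammaHat j * D.mulVec r j := by
      rw [ha, key, ← Finset.sum_sub_distrib]
      refine Finset.sum_congr rfl fun j _ => ?_
      simp only [Pi.sub_apply]
      ring
    have hapos : 0 < a := by rw [haeq]; linarith
    set Q : ℝ := ∑ i, d i ^ 2 with hQ
    have hQ0 : 0 ≤ Q := Finset.sum_nonneg fun i _ => sq_nonneg (d i)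
    have haQ : 0 < a + Q := by linarith
    set t : ℝ := a / (a + Q) with ht
    have ht0 : 0 < t := div_pos hapos haQ
    have ht1 : t ≤ 1 := by rw [ht, div_le_one haQ]; linarith
    have htm : t * (a + Q) = a := div_mul_cancel₀ _ haQ.ne'
    have hfeas : ∀ i, |(gammaHat + t • (γ - gammaHat)) i| ≤ lam := by
      intro i
      have h1 := abs_le.1 (hγ i)
      have h2 := abs_le.1 (hmem i)
      simp only [Pi.add_apply, Pi.smul_apply, Pi.sub_apply, smul_eq_mul]
      rw [abs_le]
      constructor <;> nlinarith
    have hm := isMinOn_iff.1 hmin _ hfeas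
    have e : ∑ i, (x i - D.transpose.mulVec (gammaHat + t • (γ - gammaHat)) i) ^ 2
        = ∑ i, r i ^ 2 - 2 * t * a + t ^ 2 * Q := by
      rw [ha, hQ, Finset.mul_sum, Finset.mul_sum, ← Finset.sum_sub_distrib,
        ← Finset.sum_add_distrib]
      refine Finset.sum_congr rfl fun i _ => ?_
      rw [Matrix.mulVec_add, Matrix.mulVec_smul]
      simp only [hr, hd, Pi.add_apply, Pi.smul_apply, smul_eq_mul]
      ring
    have hm' : 1 / 2 * ∑ i, r i ^ 2 ≤
      1 / 2 * ∑ i, (x i - D.transpose.mulVec (gammaHat + t • (γ - gammaHat)) i) ^ 2 := hm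
    rw [e] at hm'
    have h5 : 0 ≤ t * (t * Q - 2 * a) := by nlinarith
    have h6 := nonneg_of_mul_nonneg_right h5 ht0
    nlinarith [mul_pos ht0 hapos]
  have hsub : ∀ u : Fin L → ℝ, -(∑ i, x i * u i) + ∑ j, gammaHat j * D.mulVec u j
      = -∑ i, r i * u i := by
    intro u
    rw [← key, ← Finset.sum_neg_distrib, ← Finset.sum_neg_distrib, ← Finset.sum_add_distrib]
    refine Finset.sum_congr rfl fun i _ => ?_
    simp only [hr]
    ring
  have hl1 : lam * ∑ j, |D.mulVec r j| ≤ ∑ j, gammaHat j * D.mulVec r j := by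
    have h := hvar (fun j => if 0 ≤ D.mulVec r j then lam else -lam) (by
      intro i
      split_ifs
      · rw [abs_of_nonneg hlam]
      · rw [abs_neg, abs_of_nonneg hlam])
    refine le_trans (le_of_eq ?_) h
    rw [Finset.mul_sum]
    refine Finset.sum_congr rfl fun j _ => ?_
    split_ifs with hj
    · rw [abs_of_nonneg hj]
    · rw [abs_of_neg (not_le.1 hj)]; ring
  set s : ℝ := Real.sqrt (∑ k, r k ^ 2) with hs
  have hs0 : 0 < s := Real.sqrt_pos.2 hS
  have hss : s * s = ∑ k, r k ^ 2 := Real.mul_self_sqrt hS.le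
  rw [isMinOn_iff]
  intro u hu
  have hu' : ∑ i, u i ^ 2 ≤ 1 := hu
  change -(∑ i, x i * (r i / s)) + lam * ∑ j, |D.mulVec (fun i => r i / s) j|
    ≤ -(∑ i, x i * u i) + lam * ∑ j, |D.mulVec u j|
  have hdiv : (fun i => r i / s) = s⁻¹ • r := by
    funext i
    simp only [Pi.smul_apply, smul_eq_mul]
    ring
  have hlow : -s ≤ -(∑ i, x i * u i) + lam * ∑ j, |D.mulVec u j| := by
    have h1 : ∑ j, gammaHat j * D.mulVec u j ≤ lam * ∑ j, |D.mulVec u j| := by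
      rw [Finset.mul_sum]
      refine Finset.sum_le_sum fun j _ => ?_
      refine (le_abs_self _).trans ?_
      rw [abs_mul]
      exact mul_le_mul_of_nonneg_right (hmem j) (abs_nonneg _)
    have h2 : ∑ i, r i * u i ≤ s := by
      refine (Real.sum_mul_le_sqrt_mul_sqrt _ _ _).trans ?_
      have h3 : Real.sqrt (∑ i, u i ^ 2) ≤ 1 := Real.sqrt_le_one.2 hu'
      exact mul_le_of_le_one_right hs0.le h3
    have := hsub u
    linarith
  refine le_trans ?_ hlow
  have e1 : -(∑ i, x i * (r i / s)) + lam * ∑ j, |D.mulVec (fun i => r i / s) j|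
      = s⁻¹ * (-(∑ i, x i * r i) + lam * ∑ j, |D.mulVec r j|) := by
    have e2 : ∑ i, x i * (r i / s) = s⁻¹ * ∑ i, x i * r i := by
      rw [Finset.mul_sum]
      exact Finset.sum_congr rfl fun i _ => by ring
    have e3 : ∑ j, |D.mulVec (fun i => r i / s) j| = s⁻¹ * ∑ j, |D.mulVec r j| := by
      rw [hdiv, Matrix.mulVec_smul, Finset.mul_sum]
      refine Finset.sum_congr rfl fun j _ => ?_
      rw [Pi.smul_apply, smul_eq_mul, abs_mul, abs_of_pos (inv_pos.2 hs0)]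
    rw [e2, e3]
    ring
  rw [e1]
  have h4 : -(∑ i, x i * r i) + lam * ∑ j, |D.mulVec r j| ≤ -(s * s) := by
    have h := hsub r
    have h' : ∑ i, r i * r i = ∑ k, r k ^ 2 :=
      Finset.sum_congr rfl fun i _ => by ring
    rw [hss]
    linarith
  calc _ ≤ s⁻¹ * -(s * s) := mul_le_mul_of_nonneg_left h4 (inv_pos.2 hs0).le
    _ = -s := by field_simp
end

section
/- Let D ∈ ℝ^{m×L}, x ∈ ℝ^L, μ > 0 and λ ≥ 0. Then the infimum over u ∈ ℝ^L of the function g_{λ,μ}(u) = −⟨x, u⟩ + λ‖Du‖₁ + μ‖u‖₂² equals −(1/(4μ)) times the minimum over {γ ∈ ℝ^m : ‖γ‖_∞ ≤ λ} of ‖x − D^Tγ‖₂². -/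
open Finset

lemma aux_adj {m L : ℕ} (D : Matrix (Fin m) (Fin L) ℝ) (u : Fin L → ℝ) (γ : Fin m → ℝ) :
    ∑ i, D.transpose.mulVec γ i * u i = ∑ j, γ j * D.mulVec u j := by
  have h := Matrix.dotProduct_mulVec γ D u
  rw [← Matrix.mulVec_transpose] at h
  exact h.symm

lemma aux_exists {m L : ℕ} (D : Matrix (Fin m) (Fin L) ℝ) (x : Fin L → ℝ)
    (lam : ℝ) (hlam : 0 ≤ lam) :
    ∃ γ : Fin m → ℝ, (∀ i, |γ i| ≤ lam) ∧ ∀ γ' : Fin m → ℝ, (∀ i, |γ' i| ≤ lam) →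
      ∑ i, (x i - D.transpose.mulVec γ i) ^ 2 ≤ ∑ i, (x i - D.transpose.mulVec γ' i) ^ 2 := by
  have hc : IsCompact (Set.pi Set.univ (fun _ : Fin m => Set.Icc (-lam) lam)) :=
    isCompact_univ_pi (fun _ => isCompact_Icc)
  have hcont : Continuous (fun γ : Fin m → ℝ => ∑ i, (x i - D.transpose.mulVec γ i) ^ 2) := by
    simp only [Matrix.mulVec, dotProduct]
    fun_prop
  obtain ⟨γ, hγ, hmin⟩ := hc.exists_isMinOn
    ⟨0, fun _ _ => ⟨neg_nonpos.2 hlam, hlam⟩⟩ hcont.continuousOn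
  refine ⟨γ, fun i => abs_le.2 (hγ i trivial), fun γ' h' => ?_⟩
  exact hmin (fun i _ => abs_le.1 (h' i))

lemma aux_var {L : ℕ} (r d : Fin L → ℝ)
    (h : ∀ t : ℝ, 0 < t → t ≤ 1 → ∑ i, r i ^ 2 ≤ ∑ i, (r i - t * d i) ^ 2) :
    ∑ i, d i * r i ≤ 0 := by
  by_contra! hp
  have hd : 0 ≤ ∑ i, d i ^ 2 := Finset.sum_nonneg (fun i _ => sq_nonneg _)
  set S := ∑ i, d i * r i with hS
  set Q := ∑ i, d i ^ 2 with hQ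
  have key : ∀ t : ℝ, ∑ i, (r i - t * d i) ^ 2 = ∑ i, r i ^ 2 - 2 * t * S + t ^ 2 * Q := by
    intro t
    rw [hS, hQ, Finset.mul_sum, Finset.mul_sum, ← Finset.sum_sub_distrib, ← Finset.sum_add_distrib]
    exact Finset.sum_congr rfl (fun i _ => by ring)
  have hpos : 0 < S + Q := by linarith
  have h1 := h (S / (S + Q)) (by positivity) (by rw [div_le_one hpos]; linarith)
  rw [key] at h1
  set t := S / (S + Q) with ht
  have htS : t * (S + Q) = S := by rw [ht]; field_simp
  have htp : 0 < t := by positivity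
  have : t * (2 * S - t * Q) ≤ 0 := by nlinarith
  have h3 : t * Q = S - t * S := by linarith
  have h4 : 0 < t * S := by positivity
  have : 0 < t * (2 * S - t * Q) := by apply mul_pos htp; linarith
  linarith

/-- For `D ∈ ℝ^{m×L}`, `x ∈ ℝ^L`, `μ > 0` and `λ ≥ 0`, the infimum over `u` of
`g_{λ,μ}(u) = −⟨x,u⟩ + λ‖Du‖₁ + μ‖u‖₂²` equals `−(1/(4μ))` times the minimum of
`‖x − Dᵀγ‖₂²` over `{γ : ‖γ‖_∞ ≤ λ}`. -/
theorem stmt_10 {m L : ℕ} (D : Matrix (Fin m) (Fin L) ℝ) (x : Fin L → ℝ)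
    (μ lam : ℝ) (hμ : 0 < μ) (hlam : 0 ≤ lam) :
    (⨅ u : Fin L → ℝ,
        (-(∑ i, x i * u i) + lam * (∑ j, |D.mulVec u j|) + μ * ∑ i, u i ^ 2)) =
      -(1 / (4 * μ)) *
        ⨅ γ : {γ : Fin m → ℝ // ∀ i, |γ i| ≤ lam},
          ∑ i, (x i - D.transpose.mulVec γ.1 i) ^ 2 := by
  obtain ⟨γ, hγ, hmin⟩ := aux_exists D x lam hlam
  have hR : (⨅ γ : {γ : Fin m → ℝ // ∀ i, |γ i| ≤ lam},
          ∑ i, (x i - D.transpose.mulVec γ.1 i) ^ 2)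
      = ∑ i, (x i - D.transpose.mulVec γ i) ^ 2 := by
    refine IsLeast.csInf_eq ⟨⟨⟨γ, hγ⟩, rfl⟩, ?_⟩
    rintro _ ⟨γ', rfl⟩
    exact hmin γ'.1 γ'.2
  rw [hR]
  -- completing the square
  have hsq : ∀ u : Fin L → ℝ,
      -(∑ i, x i * u i) + ∑ j, γ j * D.mulVec u j + μ * ∑ i, u i ^ 2
        = -(1 / (4 * μ)) * ∑ i, (x i - D.transpose.mulVec γ i) ^ 2
          + μ * ∑ i, (u i - (x i - D.transpose.mulVec γ i) / (2 * μ)) ^ 2 := by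
    intro u
    rw [← aux_adj, Finset.mul_sum, Finset.mul_sum, Finset.mul_sum, ← Finset.sum_neg_distrib,
      ← Finset.sum_add_distrib, ← Finset.sum_add_distrib, ← Finset.sum_add_distrib]
    refine Finset.sum_congr rfl (fun i _ => ?_)
    field_simp
    ring
  refine IsLeast.csInf_eq ⟨⟨fun i => (x i - D.transpose.mulVec γ i) / (2 * μ), ?_⟩, ?_⟩
  · set u : Fin L → ℝ := fun i => (x i - D.transpose.mulVec γ i) / (2 * μ) with hu
    have hs := hsq u
    have hz : ∑ i, (u i - (x i - D.transpose.mulVec γ i) / (2 * μ)) ^ 2 = 0 := by simp [hu]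
    rw [hz, mul_zero, add_zero] at hs
    have hle : ∑ j, γ j * D.mulVec u j ≤ lam * ∑ j, |D.mulVec u j| := by
      rw [Finset.mul_sum]
      refine Finset.sum_le_sum (fun j _ => (le_abs_self _).trans ?_)
      rw [abs_mul]
      exact mul_le_mul_of_nonneg_right (hγ j) (abs_nonneg _)
    have hge : lam * ∑ j, |D.mulVec u j| ≤ ∑ j, γ j * D.mulVec u j := by
      set γ' : Fin m → ℝ := fun j => if 0 ≤ D.mulVec u j then lam else -lam with hγ'
      have hγ'b : ∀ j, |γ' j| ≤ lam := by
        intro j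
        simp only [hγ']
        split_ifs <;> simp [abs_of_nonneg hlam]
      have hγ's : ∑ j, γ' j * D.mulVec u j = lam * ∑ j, |D.mulVec u j| := by
        rw [Finset.mul_sum]
        refine Finset.sum_congr rfl (fun j _ => ?_)
        simp only [hγ']
        split_ifs with h
        · rw [abs_of_nonneg h]
        · rw [abs_of_neg (not_le.1 h)]; ring
      have hv := aux_var (fun i => x i - D.transpose.mulVec γ i)
        (D.transpose.mulVec (γ' - γ)) (by
          intro t ht0 ht1
          refine (hmin (γ + t • (γ' - γ)) ?_).trans (le_of_eq ?_)
          · intro j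
            have e : (γ + t • (γ' - γ)) j = (1 - t) * γ j + t * γ' j := by
              simp; ring
            rw [e]
            have a := abs_le.1 (hγ j)
            have b := abs_le.1 (hγ'b j)
            rw [abs_le]
            constructor <;> nlinarith
          · refine Finset.sum_congr rfl (fun i _ => ?_)
            rw [Matrix.mulVec_add, Matrix.mulVec_smul]
            simp only [Pi.add_apply, Pi.smul_apply, smul_eq_mul]
            ring)
      have hv2 : ∑ i, D.transpose.mulVec (γ' - γ) i * u i ≤ 0 := by
        have : ∑ i, D.transpose.mulVec (γ' - γ) i * u i
            = (∑ i, D.transpose.mulVec (γ' - γ) i * (x i - D.transpose.mulVec γ i)) / (2 * μ) := by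
          rw [Finset.sum_div]
          exact Finset.sum_congr rfl (fun i _ => by simp only [hu]; ring)
        rw [this]
        exact div_nonpos_of_nonpos_of_nonneg hv (by positivity)
      rw [aux_adj] at hv2
      simp only [Pi.sub_apply, sub_mul, Finset.sum_sub_distrib] at hv2
      linarith
    show -(∑ i, x i * u i) + lam * (∑ j, |D.mulVec u j|) + μ * ∑ i, u i ^ 2 = _
    linarith
  · rintro _ ⟨u, rfl⟩
    have hs := hsq u
    have hle : ∑ j, γ j * D.mulVec u j ≤ lam * ∑ j, |D.mulVec u j| := by
      rw [Finset.mul_sum]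
      refine Finset.sum_le_sum (fun j _ => (le_abs_self _).trans ?_)
      rw [abs_mul]
      exact mul_le_mul_of_nonneg_right (hγ j) (abs_nonneg _)
    have hn : 0 ≤ μ * ∑ i, (u i - (x i - D.transpose.mulVec γ i) / (2 * μ)) ^ 2 := by positivity
    show _ ≤ -(∑ i, x i * u i) + lam * (∑ j, |D.mulVec u j|) + μ * ∑ i, u i ^ 2
    linarith
end

section
/- Let D ∈ ℝ^{m×L}, x ∈ ℝ^L and λ > 0, and consider the function u ↦ −⟨x, u⟩ + λ‖Du‖₁ on ℝ^L. (i) If x ∉ Range(D^T), then this function is unbounded below (its infimum is −∞). (ii) If there exists γ ∈ ℝ^m with D^Tγ = x and ‖γ‖_∞ ≤ λ, then its infimum over ℝ^L equals 0. -/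
open Finset

/-- For `D ∈ ℝ^{m×L}`, `x ∈ ℝ^L`, `λ > 0` and the function `u ↦ −⟨x,u⟩ + λ‖Du‖₁`:
(i) if `x ∉ Range(Dᵀ)` the function is unbounded below; (ii) if `Dᵀγ = x` for some `γ` with
`‖γ‖_∞ ≤ λ`, its infimum over `ℝ^L` equals `0`. -/
theorem stmt_11 {m L : ℕ} (D : Matrix (Fin m) (Fin L) ℝ) (x : Fin L → ℝ)
    (lam : ℝ) (hlam : 0 < lam) :
    ((x ∉ Set.range D.transpose.mulVec) →
      ∀ M : ℝ, ∃ u : Fin L → ℝ, -(∑ i, x i * u i) + lam * (∑ j, |D.mulVec u j|) < M) ∧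
    ((∃ γ : Fin m → ℝ, D.transpose.mulVec γ = x ∧ ∀ i, |γ i| ≤ lam) →
      (⨅ u : Fin L → ℝ, (-(∑ i, x i * u i) + lam * ∑ j, |D.mulVec u j|)) = 0) := by
  constructor
  · intro hx M
    have hx' : x ∉ LinearMap.range D.transpose.mulVecLin := by
      rintro ⟨g, hg⟩
      exact hx ⟨g, hg⟩
    obtain ⟨f, hf, hle⟩ := Submodule.exists_le_ker_of_notMem hx'
    obtain ⟨w, hw⟩ : ∃ w : Fin L → ℝ, ∀ v, f v = v ⬝ᵥ w := by
      refine ⟨fun i => f (Pi.single i 1), fun v => ?_⟩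
      conv_lhs => rw [pi_eq_sum_univ' v]
      simp [map_sum, dotProduct]
    have hD : D.mulVec w = 0 := by
      have h : D.transpose.mulVec (D.mulVec w) ⬝ᵥ w = 0 := by
        rw [← hw]
        exact hle ⟨D.mulVec w, rfl⟩
      rw [Matrix.mulVec_transpose, ← Matrix.dotProduct_mulVec] at h
      exact dotProduct_self_eq_zero.mp h
    rw [hw] at hf
    refine ⟨((1 - M) / (x ⬝ᵥ w)) • w, ?_⟩
    have h1 : ∑ i, x i * (((1 - M) / (x ⬝ᵥ w)) • w) i = 1 - M := by
      change x ⬝ᵥ (((1 - M) / (x ⬝ᵥ w)) • w) = 1 - M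
      rw [dotProduct_smul, smul_eq_mul]
      field_simp
    rw [h1, Matrix.mulVec_smul, hD]
    simp
  · rintro ⟨g, rfl, hg⟩
    have key : ∀ u : Fin L → ℝ,
        0 ≤ -(∑ i, D.transpose.mulVec g i * u i) + lam * ∑ j, |D.mulVec u j| := by
      intro u
      have h1 : ∑ i, D.transpose.mulVec g i * u i = ∑ j, g j * D.mulVec u j := by
        change D.transpose.mulVec g ⬝ᵥ u = g ⬝ᵥ D.mulVec u
        rw [Matrix.mulVec_transpose, ← Matrix.dotProduct_mulVec]
      have h2 : ∑ j, g j * D.mulVec u j ≤ lam * ∑ j, |D.mulVec u j| := by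
        rw [Finset.mul_sum]
        refine Finset.sum_le_sum fun j _ => ?_
        refine (le_abs_self _).trans ?_
        rw [abs_mul]
        exact mul_le_mul_of_nonneg_right (hg j) (abs_nonneg _)
      linarith
    apply le_antisymm
    · refine (ciInf_le ⟨0, ?_⟩ (0 : Fin L → ℝ)).trans ?_
      · rintro _ ⟨u, rfl⟩
        exact key u
      · simp
    · exact le_ciInf key
end

section
/- Let D ∈ ℝ^{m×L}, λ > 0, and y ∈ ℝ^L with y ∉ Range(D^T). Let û be a minimizer over ℝ^L of the generalized lasso objective ½‖y − u‖₂² + λ‖Du‖₁. Then û ≠ 0, and the normalized vector û/‖û‖₂ is a minimizer of −⟨y, u⟩ + λ‖Du‖₁ over the set {u ∈ ℝ^L : ‖u‖₂² ≤ 1}. -/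
open Finset

/-- If `y ∉ Range(Dᵀ)`, `λ > 0`, and `û` minimizes the generalized-lasso objective
`½‖y − u‖₂² + λ‖Du‖₁` over `ℝ^L`, then `û ≠ 0` and `û/‖û‖₂` minimizes
`−⟨y,u⟩ + λ‖Du‖₁` over the unit ball `{u : ‖u‖₂² ≤ 1}`. -/
theorem stmt_13 {m L : ℕ} (D : Matrix (Fin m) (Fin L) ℝ)
    (lam : ℝ) (hlam : 0 < lam)
    (y : Fin L → ℝ) (hy : y ∉ Set.range D.transpose.mulVec)
    (uhat : Fin L → ℝ)
    (hmin : ∀ u : Fin L → ℝ,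
      (1 / 2) * (∑ i, (y i - uhat i) ^ 2) + lam * (∑ j, |D.mulVec uhat j|) ≤
        (1 / 2) * (∑ i, (y i - u i) ^ 2) + lam * (∑ j, |D.mulVec u j|)) :
    uhat ≠ 0 ∧
    IsMinOn (fun u : Fin L → ℝ => -(∑ i, y i * u i) + lam * ∑ j, |D.mulVec u j|)
      {u : Fin L → ℝ | (∑ i, u i ^ 2) ≤ 1}
      (fun i => uhat i / Real.sqrt (∑ k, uhat k ^ 2)) := by
  have key : ∀ (u : Fin L → ℝ) (t : ℝ), 0 ≤ t →
      (1 / 2) * (∑ i, uhat i ^ 2) + (-(∑ i, y i * uhat i) + lam * ∑ j, |D.mulVec uhat j|) ≤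
      (t ^ 2 / 2) * (∑ i, u i ^ 2) + t * (-(∑ i, y i * u i) + lam * ∑ j, |D.mulVec u j|) := by
    intro u t ht
    have h := hmin (t • u)
    have e : ∀ w : Fin L → ℝ, ∑ i, (y i - w i) ^ 2
        = ∑ i, y i ^ 2 - 2 * ∑ i, y i * w i + ∑ i, w i ^ 2 := by
      intro w
      rw [Finset.mul_sum, ← Finset.sum_sub_distrib, ← Finset.sum_add_distrib]
      exact Finset.sum_congr rfl fun i _ => by ring
    have e1 : ∑ i, y i * (t • u) i = t * ∑ i, y i * u i := by
      rw [Finset.mul_sum]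
      exact Finset.sum_congr rfl fun i _ => by simp; ring
    have e2 : ∑ i, (t • u) i ^ 2 = t ^ 2 * ∑ i, u i ^ 2 := by
      rw [Finset.mul_sum]
      exact Finset.sum_congr rfl fun i _ => by simp; ring
    have e3 : ∑ j, |D.mulVec (t • u) j| = t * ∑ j, |D.mulVec u j| := by
      rw [Finset.mul_sum, Matrix.mulVec_smul]
      exact Finset.sum_congr rfl fun i _ => by simp [abs_mul, abs_of_nonneg ht]
    rw [e, e, e1, e2, e3] at h
    nlinarith [h]
  have hne : uhat ≠ 0 := by
    rintro rfl
    have pos : ∀ u : Fin L → ℝ, 0 ≤ -(∑ i, y i * u i) + lam * ∑ j, |D.mulVec u j| := by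
      intro u
      by_contra hneg
      push Not at hneg
      set g := -(∑ i, y i * u i) + lam * ∑ j, |D.mulVec u j| with hg
      have hN : 0 ≤ ∑ i, u i ^ 2 := Finset.sum_nonneg fun i _ => sq_nonneg _
      set N := ∑ i, u i ^ 2 with hNd
      have ht : 0 < -g / (N + 1) := by apply div_pos <;> linarith
      have h := key u (-g / (N + 1)) ht.le
      simp only [Pi.zero_apply, Matrix.mulVec_zero] at h
      rw [← hg, ← hNd] at h
      simp at h
      set t := -g / (N + 1) with htd
      have h1 : t * (N + 1) = -g := by rw [htd]; field_simp
      have h2 : t ^ 2 / 2 * N + t * g = - (t ^ 2 * (N / 2 + 1)) := by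
        have : g = - (t * (N + 1)) := by linarith
        rw [this]; ring
      have h3 : 0 < t ^ 2 * (N / 2 + 1) := by positivity
      simp only [htd] at h2 h3
      have h4 : 0 ≤ (-g / (N + 1)) ^ 2 / 2 * N + (-g / (N + 1)) * g := by
        simpa using h
      linarith
    have hy' : y ∉ LinearMap.range (Matrix.mulVecLin D.transpose) := by
      rintro ⟨x, hx⟩
      exact hy ⟨x, hx⟩
    obtain ⟨f, hf, hker⟩ := Submodule.exists_le_ker_of_notMem hy'
    let v : Fin L → ℝ := fun i => f (Pi.single i 1)
    have hfv : ∀ w : Fin L → ℝ, f w = ∑ i, w i * v i := by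
      intro w
      rw [LinearMap.pi_apply_eq_sum_univ f w]
      refine Finset.sum_congr rfl fun i _ => ?_
      simp only [v, smul_eq_mul]
      congr 2
      ext j
      simp [Pi.single_apply, eq_comm]
    have hDv : D.mulVec v = 0 := by
      ext j
      have h := hker (⟨Pi.single j 1, rfl⟩ :
        Matrix.mulVecLin D.transpose (Pi.single j 1) ∈ LinearMap.range (Matrix.mulVecLin D.transpose))
      rw [LinearMap.mem_ker, hfv] at h
      simpa [Matrix.mulVec, dotProduct, Pi.single_apply] using h
    have h1 := pos v
    have h2 := pos (-v)
    rw [Matrix.mulVec_neg] at h2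
    rw [hDv] at h1 h2
    simp at h1 h2
    apply hf
    rw [hfv]
    linarith
  refine ⟨hne, ?_⟩
  have hn : 0 < ∑ k, uhat k ^ 2 := by
    obtain ⟨i, hi⟩ := Function.ne_iff.mp hne
    exact Finset.sum_pos' (fun i _ => sq_nonneg _) ⟨i, Finset.mem_univ _, by
      have : uhat i ≠ 0 := hi
      positivity⟩
  intro u hu
  simp only [Set.mem_ofPred_eq] at hu ⊢
  have hs := Real.sqrt_pos.mpr hn
  have hss := Real.sq_sqrt hn.le
  set s := Real.sqrt (∑ k, uhat k ^ 2) with hsd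
  have hfun : (fun i => uhat i / s) = s⁻¹ • uhat := by
    ext i; simp [div_eq_inv_mul]
  have e1 : ∑ i, y i * (uhat i / s) = s⁻¹ * ∑ i, y i * uhat i := by
    rw [Finset.mul_sum]
    exact Finset.sum_congr rfl fun i _ => by ring
  have e3 : ∑ j, |D.mulVec (fun i => uhat i / s) j| = s⁻¹ * ∑ j, |D.mulVec uhat j| := by
    rw [Finset.mul_sum, hfun, Matrix.mulVec_smul]
    exact Finset.sum_congr rfl fun i _ => by simp [abs_mul, abs_of_pos hs]
  rw [e1, e3]
  have k0 := key u s hs.le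
  have k1 := key uhat
  rw [← hss] at k0 k1
  set G := -(∑ i, y i * uhat i) + lam * ∑ j, |D.mulVec uhat j| with hG
  set g := -(∑ i, y i * u i) + lam * ∑ j, |D.mulVec u j| with hg
  have hGE : G = - s ^ 2 := by
    -- take t = -G/s^2 if G ≤ 0, else t = 0
    have hs2 : 0 < s ^ 2 := by positivity
    rcases le_total G 0 with h | h
    · have h1 := k1 (-G / s ^ 2) (div_nonneg (by linarith) hs2.le)
      have h2 : (-G / s ^ 2) ^ 2 / 2 * s ^ 2 + -G / s ^ 2 * G = - (G ^ 2 / s ^ 2) / 2 := by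
        field_simp; ring
      have h3 : G ^ 2 / s ^ 2 * s ^ 2 = G ^ 2 := by field_simp
      rw [h2] at h1
      have h4 : (G + s ^ 2) ^ 2 ≤ 0 := by nlinarith
      have := pow_eq_zero_iff (two_ne_zero) |>.mp (le_antisymm h4 (sq_nonneg _))
      linarith
    · have h1 := k1 0 le_rfl
      nlinarith
  have hl : -(s⁻¹ * ∑ i, y i * uhat i) + lam * (s⁻¹ * ∑ j, |D.mulVec uhat j|) = -s := by
    have : -(s⁻¹ * ∑ i, y i * uhat i) + lam * (s⁻¹ * ∑ j, |D.mulVec uhat j|) = s⁻¹ * G := by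
      rw [hG]; ring
    rw [this, hGE]; field_simp
  rw [hl]
  have : 0 ≤ s * (s + g) := by nlinarith [mul_le_mul_of_nonneg_left hu (sq_nonneg s)]
  have := nonneg_of_mul_nonneg_right this hs
  linarith
end

section
/- Let D ∈ ℝ^{m×L}, c > 0, and x ∈ ℝ^L with x ∉ Range(D^T). Then every maximizer u* of ⟨x, u⟩ over the set {u ∈ ℝ^L : ‖u‖₂² ≤ 1, ‖Du‖₁ ≤ c} satisfies ‖u*‖₂ = 1; that is, the solution of the relaxed problem lies on the boundary of the unit ball. -/
open Finset

/-- If `x ∉ Range(Dᵀ)` and `c > 0`, every maximizer `u*` of `⟨x,u⟩` over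
`{u : ‖u‖₂² ≤ 1, ‖Du‖₁ ≤ c}` satisfies `‖u*‖₂ = 1`. -/
theorem stmt_14 {m L : ℕ} (D : Matrix (Fin m) (Fin L) ℝ) (c : ℝ) (hc : 0 < c)
    (x : Fin L → ℝ) (hx : x ∉ Set.range D.transpose.mulVec)
    (ustar : Fin L → ℝ)
    (hmem : ustar ∈ {u : Fin L → ℝ | (∑ i, u i ^ 2) ≤ 1 ∧ (∑ j, |D.mulVec u j|) ≤ c})
    (hmax : IsMaxOn (fun u : Fin L → ℝ => ∑ i, x i * u i)
      {u : Fin L → ℝ | (∑ i, u i ^ 2) ≤ 1 ∧ (∑ j, |D.mulVec u j|) ≤ c} ustar) :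
    Real.sqrt (∑ i, ustar i ^ 2) = 1 := by
  obtain ⟨h1, h2⟩ := hmem
  obtain ⟨v, hDv, hxv⟩ : ∃ v : Fin L → ℝ, D.mulVec v = 0 ∧ 0 < ∑ i, x i * v i := by
    have hx' : x ∉ LinearMap.range D.transpose.mulVecLin := by
      rintro ⟨y, hy⟩
      exact hx ⟨y, hy⟩
    obtain ⟨f, hf, hW⟩ := Submodule.exists_le_ker_of_notMem hx'
    have key : ∀ y : Fin L → ℝ, f y = ∑ i, y i * f (Pi.single i 1) := by
      intro y
      conv_lhs => rw [LinearMap.pi_apply_eq_sum_univ f y]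
      refine Finset.sum_congr rfl fun i _ => ?_
      rw [smul_eq_mul]
      congr 2
      ext j
      simp [Pi.single_apply, eq_comm]
    refine ⟨f x • fun i => f (Pi.single i 1), ?_, ?_⟩
    · rw [Matrix.mulVec_smul]
      have : D.mulVec (fun i => f (Pi.single i 1)) = 0 := by
        ext j
        have h := hW (LinearMap.mem_range_self D.transpose.mulVecLin (Pi.single j 1))
        rw [LinearMap.mem_ker, key] at h
        simpa [Matrix.mulVec, dotProduct] using h
      rw [this, smul_zero]
    · have : ∑ i, x i * (f x • fun i => f (Pi.single i 1)) i = f x * f x := by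
        conv_rhs => rw [key x]
        rw [← key x, key x, Finset.mul_sum]
        refine Finset.sum_congr rfl fun i _ => ?_
        simp only [Pi.smul_apply, smul_eq_mul]
        ring
      rw [this]
      exact mul_self_pos.mpr hf
  rw [Real.sqrt_eq_one]
  by_contra hne
  have hlt : ∑ i, ustar i ^ 2 < 1 := lt_of_le_of_ne h1 hne
  have hcont : Continuous fun t : ℝ => ∑ i, (ustar i + t * v i) ^ 2 := by fun_prop
  have hev : ∀ᶠ t in nhds (0 : ℝ), ∑ i, (ustar i + t * v i) ^ 2 < 1 :=
    hcont.continuousAt.eventually_lt continuousAt_const (by simpa using hlt)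
  obtain ⟨t, ht, htpos⟩ :=
    ((hev.filter_mono (nhdsWithin_le_nhds (s := Set.Ioi 0))).and self_mem_nhdsWithin).exists
  have hm : ustar + t • v ∈
      {u : Fin L → ℝ | (∑ i, u i ^ 2) ≤ 1 ∧ (∑ j, |D.mulVec u j|) ≤ c} := by
    refine ⟨?_, ?_⟩
    · simpa using ht.le
    · rw [Matrix.mulVec_add, Matrix.mulVec_smul, hDv, smul_zero, add_zero]
      exact h2
  have h := hmax hm
  have e : ∑ i, x i * (ustar + t • v) i = ∑ i, x i * ustar i + t * ∑ i, x i * v i := by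
    rw [Finset.mul_sum, ← Finset.sum_add_distrib]
    refine Finset.sum_congr rfl fun i _ => ?_
    simp only [Pi.add_apply, Pi.smul_apply, smul_eq_mul]
    ring
  simp only [Set.mem_ofPred_eq] at h
  rw [e] at h
  have := mul_pos (Set.mem_Ioi.mp htpos) hxv
  linarith
end
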